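/- Centroid-based root finding in uniform attachment trees: let ε ∈ (0,1) and let K be an integer with K ≥ (5/2)·ln(1/ε)/ε. For the random recursive tree T_n, let H_ψ(T_n) be a set of K vertices of T_n attaining the K smallest values of ψ_{T_n}. Then liminf_{n→∞} P( vertex 1 ∈ H_ψ(T_n) ) ≥ 1 − 4ε/(1−ε). -/

import Mathlib

open MeasureTheory ProbabilityTheory Filter
open scoped BigOperators ENNReal Topology Classical

/-- Sample space encoding the attachment choices of the uniform attachment (random
recursive) tree on `n + 1` vertices: for each `j : Fin n`, vertex `j + 1` attaches to a
vertex chosen from `{0, 1, …, j}`. -/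
abbrev TreeSpace (n : ℕ) := (j : Fin n) → Fin (j.1 + 1)

/-- The uniform measure on attachment choices: each new vertex chooses its neighbor
uniformly at random among the existing vertices, independently of the past. -/
noncomputable def treeMeasure (n : ℕ) : Measure (TreeSpace n) :=
  Measure.pi fun j => (PMF.uniformOfFintype (Fin (j.1 + 1))).toMeasure

/-- The parent of a vertex in the uniform attachment tree encoded by `ω` (the root `0` is
assigned itself as parent). -/
def parentVx {n : ℕ} (ω : TreeSpace n) (v : Fin (n + 1)) : Fin (n + 1) :=
  if h : v.1 = 0 then 0
  else Fin.castLE (by omega)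
    (ω ⟨v.1 - 1, by have := v.2; omega⟩)

/-- The uniform attachment tree on `n + 1` vertices encoded by `ω`, as a simple graph:
each non-root vertex is adjacent to its parent. -/
def attachGraph {n : ℕ} (ω : TreeSpace n) : SimpleGraph (Fin (n + 1)) :=
  SimpleGraph.fromRel fun i j => parentVx ω j = i

/-- `ψ_T(v)`: the number of vertices of the largest connected component of the forest
obtained from the tree `T` (encoded by `ω`) by removing the vertex `v`. -/
noncomputable def psiVal {n : ℕ} (ω : TreeSpace n) (v : Fin (n + 1)) : ℕ :=
  ⨆ c : ((attachGraph ω).induce ({v}ᶜ : Set (Fin (n + 1)))).ConnectedComponent,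
    c.supp.ncard

/-- The first vertex `< k` met when following `f` from `v`. -/
def ancV (k : ℕ) (f : ℕ → ℕ) (v : ℕ) : ℕ :=
  if h : v < k ∨ v ≤ f v then v else ancV k f (f v)
termination_by v
decreasing_by omega

lemma ancV_lt (k : ℕ) (f : ℕ → ℕ) (v : ℕ) (h : v < k) : ancV k f v = v := by
  rw [ancV, dif_pos (Or.inl h)]

lemma ancV_ge (k : ℕ) (f : ℕ → ℕ) (v : ℕ) (h : k ≤ v) (h2 : f v < v) :
    ancV k f v = ancV k f (f v) := by
  rw [ancV, dif_neg (by omega)]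

lemma ancV_congr (k : ℕ) (f g : ℕ → ℕ) (v : ℕ) (h : ∀ u ≤ v, f u = g u) :
    ancV k f v = ancV k g v := by
  induction v using Nat.strong_induction_on with
  | _ v ih =>
    by_cases hv : v < k ∨ v ≤ f v
    · rw [ancV, dif_pos hv, ancV, dif_pos (by rw [← h v le_rfl]; exact hv)]
    · rw [ancV, dif_neg hv, ancV.eq_1 k g v, dif_neg (by rw [← h v le_rfl]; exact hv), ← h v le_rfl]
      exact ih _ (by omega) (fun u hu => h u (by omega))

lemma ancV_mem (k : ℕ) (hk : 0 < k) (f : ℕ → ℕ) (n v : ℕ) (hv : v ≤ n)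
    (h : ∀ u, 0 < u → u ≤ n → f u < u) : ancV k f v < k := by
  induction v using Nat.strong_induction_on with
  | _ v ih =>
    by_cases hv' : v < k
    · rw [ancV_lt k f v hv']; exact hv'
    · have := h v (by omega) hv
      rw [ancV_ge k f v (by omega) this]
      exact ih _ this (by omega)

/-- Size of the subtree hanging from `j`. -/
def cntV (k : ℕ) (f : ℕ → ℕ) (j N : ℕ) : ℕ := ((Finset.range N).filter (fun v => ancV k f v = j)).card

lemma cntV_succ (k : ℕ) (f : ℕ → ℕ) (j N : ℕ) :
    cntV k f j (N + 1) = cntV k f j N + if ancV k f N = j then 1 else 0 := by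
  unfold cntV
  rw [Finset.range_add_one, Finset.filter_insert]
  split_ifs with h
  · rw [Finset.card_insert_of_notMem (by simp)]
  · rfl

lemma cntV_congr (k : ℕ) (f g : ℕ → ℕ) (j N : ℕ) (h : ∀ u < N, f u = g u) :
    cntV k f j N = cntV k g j N := by
  unfold cntV
  congr 1
  apply Finset.filter_congr
  intro v hv
  rw [ancV_congr k f g v (fun u hu => h u (by have := Finset.mem_range.1 hv; omega))]

lemma cntV_le (k : ℕ) (f : ℕ → ℕ) (j N : ℕ) : cntV k f j N ≤ N := by
  unfold cntV
  exact (Finset.card_filter_le _ _).trans (by simp)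

/-- Parent function on naturals. -/
def parN {n : ℕ} (ω : TreeSpace n) (v : ℕ) : ℕ :=
  if h : 0 < v ∧ v ≤ n then (ω ⟨v - 1, by omega⟩).1 else 0

lemma parN_lt {n : ℕ} (ω : TreeSpace n) (v : ℕ) (h : 0 < v) : parN ω v < v := by
  unfold parN
  split_ifs with h'
  · have := (ω ⟨v - 1, by omega⟩).2
    simp only at this
    omega
  · exact h

lemma parentVx_val {n : ℕ} (ω : TreeSpace n) (v : Fin (n + 1)) :
    (parentVx ω v).1 = parN ω v.1 := by
  unfold parentVx parN
  have := v.2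
  by_cases h : v.1 = 0
  · rw [dif_pos h, dif_neg (by omega)]; rfl
  · rw [dif_neg h, dif_pos (by omega)]; rfl

/-- Splitting off the last attachment choice. -/
def tsEquiv (n : ℕ) : TreeSpace n × Fin (n + 1) ≃ TreeSpace (n + 1) where
  toFun p := Fin.snoc (α := fun j : Fin (n + 1) => Fin (j.1 + 1)) p.1 p.2
  invFun q := (fun j => q j.castSucc, q (Fin.last n))
  left_inv p := by
    ext1
    · funext j; simp
    · simp
  right_inv q := by
    funext j
    refine Fin.lastCases ?_ (fun i => ?_) j <;> simp

lemma parN_snoc_le {n : ℕ} (ω : TreeSpace n) (x : Fin (n + 1)) (v : ℕ) (hv : v < n + 1) :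
    parN (tsEquiv n (ω, x)) v = parN ω v := by
  unfold parN
  by_cases h : 0 < v
  · rw [dif_pos (by omega), dif_pos (by omega)]
    have : (⟨v - 1, by omega⟩ : Fin (n + 1)) = Fin.castSucc ⟨v - 1, by omega⟩ := rfl
    simp only [tsEquiv, Equiv.coe_fn_mk]
    rw [show (Fin.snoc (α := fun j : Fin (n + 1) => Fin (j.1 + 1)) ω x ⟨v - 1, by omega⟩)
      = (Fin.snoc (α := fun j : Fin (n + 1) => Fin (j.1 + 1)) ω x (Fin.castSucc ⟨v - 1, by omega⟩)) from rfl,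
      Fin.snoc_castSucc]
  · rw [dif_neg (by omega), dif_neg (by omega)]

lemma parN_snoc_last {n : ℕ} (ω : TreeSpace n) (x : Fin (n + 1)) :
    parN (tsEquiv n (ω, x)) (n + 1) = x.1 := by
  unfold parN
  rw [dif_pos (by omega)]
  simp only [tsEquiv, Equiv.coe_fn_mk]
  rw [show (Fin.snoc (α := fun j : Fin (n + 1) => Fin (j.1 + 1)) ω x ⟨n + 1 - 1, by omega⟩)
      = (Fin.snoc (α := fun j : Fin (n + 1) => Fin (j.1 + 1)) ω x (Fin.last n)) from rfl,
      Fin.snoc_last]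

lemma cntV_snoc {n : ℕ} (k j : ℕ) (hk : k ≤ n + 1) (ω : TreeSpace n) (x : Fin (n + 1)) :
    cntV k (parN (tsEquiv n (ω, x))) j (n + 2) =
      cntV k (parN ω) j (n + 1) + if ancV k (parN ω) x.1 = j then 1 else 0 := by
  rw [cntV_succ, cntV_congr k _ _ j (n + 1) (parN_snoc_le ω x),
    ancV_ge k _ (n + 1) hk (parN_lt _ _ (by omega)), parN_snoc_last,
    ancV_congr k _ (parN ω) x.1 (fun u hu => parN_snoc_le ω x u (by omega))]

lemma card_fin_anc {n : ℕ} (k j : ℕ) (ω : TreeSpace n) :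
    (Finset.univ.filter (fun x : Fin (n + 1) => ancV k (parN ω) x.1 = j)).card =
      cntV k (parN ω) j (n + 1) := by
  unfold cntV
  rw [Finset.card_filter, Finset.card_filter, ← Fin.sum_univ_eq_sum_range
    (fun v => if ancV k (parN ω) v = j then 1 else 0)]

/-- Number of trees with large subtree. -/
noncomputable def numA (k j n s : ℕ) : ℕ :=
  ∑ ω : TreeSpace n, if s ≤ cntV k (parN ω) j (n + 1) then 1 else 0

lemma numA_succ (k j n s : ℕ) (hk : k ≤ n + 1) :
    (numA k j (n + 1) (s + 1) : ℝ) = (n + 1 - s) * numA k j n (s + 1) + s * numA k j n s := by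
  unfold numA
  rw [← (tsEquiv n).sum_comp, Fintype.sum_prod_type]
  push_cast
  rw [Finset.mul_sum, Finset.mul_sum, ← Finset.sum_add_distrib]
  refine Finset.sum_congr rfl (fun ω _ => ?_)
  simp_rw [cntV_snoc k j hk]
  have hc := card_fin_anc k j ω
  set c := cntV k (parN ω) j (n + 1) with hcdef
  rcases lt_trichotomy c s with h | h | h
  · rw [if_neg (by omega), if_neg (by omega), Finset.sum_eq_zero]
    · simp
    · intro x _
      rw [if_neg (by split_ifs <;> omega)]
  · rw [if_neg (by omega), if_pos (by omega)]
    have : ∀ x : Fin (n + 1), (if s + 1 ≤ c + (if ancV k (parN ω) x.1 = j then 1 else 0) then (1 : ℝ) else 0)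
        = if ancV k (parN ω) x.1 = j then 1 else 0 := by
      intro x
      by_cases hx : ancV k (parN ω) x.1 = j
      · rw [if_pos hx, if_pos hx, if_pos (by omega)]
      · rw [if_neg hx, if_neg hx, if_neg (by omega)]
    rw [Finset.sum_congr rfl (fun x _ => this x), Finset.sum_boole, hc, h]
    ring
  · rw [if_pos (by omega), if_pos (by omega)]
    rw [Finset.sum_congr rfl (fun x _ => if_pos (by omega))]
    simp

lemma card_TS (n : ℕ) : Fintype.card (TreeSpace n) = n.factorial := by
  rw [Fintype.card_pi]
  simp only [Fintype.card_fin]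
  rw [Fin.prod_univ_eq_prod_range (fun i => i + 1) n, Finset.prod_range_add_one_eq_factorial]

lemma choose_id (m r : ℕ) : ((m + 1 : ℕ) : ℝ) * (m.choose r) = ((m : ℝ) + 1 - r) * ((m + 1).choose r) := by
  rcases le_or_gt r (m + 1) with h | h
  · have := Nat.add_one_mul_choose_eq m r
    have h2 := Nat.choose_succ_right_eq (m + 1) r
    have h3 := this.trans h2
    have h4 : ((m + 1 : ℕ) : ℝ) * (m.choose r) = ((m + 1).choose r) * ((m + 1 - r : ℕ) : ℝ) := by
      exact_mod_cast h3
    rw [h4, Nat.cast_sub h]; push_cast; ring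
  · rw [Nat.choose_eq_zero_of_lt h, Nat.choose_eq_zero_of_lt (by omega)]; simp

lemma numA_eq (r j : ℕ) (hr : 1 ≤ r) (hj : j < r + 1) (d : ℕ) : ∀ s : ℕ,
    (numA (r + 1) j (r + d) (s + 1) : ℝ) * (r + d).choose r
      = (r + d).factorial * (r + d - s).choose r := by
  induction d with
  | zero =>
    intro s
    have hc : ∀ ω : TreeSpace (r + 0), cntV (r + 1) (parN ω) j (r + 0 + 1) = 1 := by
      intro ω
      unfold cntV
      rw [Finset.card_eq_one]
      refine ⟨j, ?_⟩
      ext v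
      simp only [Finset.mem_filter, Finset.mem_range, Finset.mem_singleton]
      constructor
      · rintro ⟨h1, h2⟩
        rwa [ancV_lt _ _ _ (by omega)] at h2
      · rintro rfl
        exact ⟨by omega, ancV_lt _ _ _ (by omega)⟩
    unfold numA
    simp_rw [hc]
    rcases Nat.eq_zero_or_pos s with rfl | hs
    · have hT := card_TS r
      have h2 : (∑ ω : TreeSpace (r + 0), if 0 + 1 ≤ 1 then 1 else 0) = r.factorial := by
        rw [← hT, Finset.sum_congr rfl (fun ω _ => if_pos le_rfl), Finset.sum_const, smul_eq_mul,
          mul_one, Finset.card_univ]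
        rfl
      rw [h2]; simp
    · rw [Nat.choose_eq_zero_of_lt (show r + 0 - s < r by omega)]
      rw [Finset.sum_eq_zero (fun ω _ => if_neg (by omega))]
      simp
  | succ d ih =>
    intro s
    have hC := choose_id (r + d) r
    have hF : ((r + (d + 1)).factorial : ℝ) = (r + d + 1) * (r + d).factorial := by
      rw [← add_assoc, Nat.factorial_succ]; push_cast; ring
    have hd : (0 : ℝ) < (d : ℝ) + 1 := by positivity
    have hrec := numA_succ (r + 1) j (r + d) s (by omega)
    rw [← add_assoc] at hF ⊢
    rw [hrec, hF]
    push_cast at hC ⊢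
    apply mul_left_cancel₀ hd.ne'
    have hC' : ((r : ℝ) + d + 1) * ((r + d).choose r) = (d + 1) * ((r + d + 1).choose r) := by
      rw [hC]; ring
    have key : ((r : ℝ) + d + 1 - s) * (r + d - s).choose r + s * (r + d + 1 - s).choose r
        = (d + 1) * (r + d + 1 - s).choose r := by
      rcases le_or_gt s (r + d) with h | h
      · obtain ⟨m, hm⟩ := Nat.exists_eq_add_of_le h
        have e1 : r + d - s = m := by omega
        have e2 : r + d + 1 - s = m + 1 := by omega
        have := choose_id m r
        rw [e1, e2]
        have hm' : (r : ℝ) + d = s + m := by exact_mod_cast hm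
        have h1 : (r : ℝ) + d + 1 - s = m + 1 := by linarith
        have h2 : (d : ℝ) = s + m - r := by linarith
        rw [h1, h2]
        push_cast at this
        rw [this]; ring
      · rw [Nat.choose_eq_zero_of_lt (show r + d - s < r by omega),
          Nat.choose_eq_zero_of_lt (show r + d + 1 - s < r by omega)]
        simp
    rcases Nat.eq_zero_or_pos s with rfl | hs
    · have i0 := ih 0
      simp only [Nat.sub_zero, Nat.cast_zero, sub_zero, zero_mul, add_zero] at *
      linear_combination (-((r : ℝ) + d + 1) * numA (r + 1) j (r + d) (0 + 1)) * hC' + ((r : ℝ) + d + 1) ^ 2 * i0 + ((r:ℝ) + d + 1) * (r + d).factorial * key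
    · obtain ⟨t, rfl⟩ : ∃ t, s = t + 1 := ⟨s - 1, by omega⟩
      have i0 := ih (t + 1)
      have i1 := ih t
      rw [show r + d + 1 - (t + 1) = r + d - t by omega] at *
      push_cast at *
      linear_combination (-((r : ℝ) + d + 1 - (t + 1)) * numA (r + 1) j (r + d) (t + 1 + 1) - (t + 1) * numA (r + 1) j (r + d) (t + 1)) * hC' + ((r : ℝ) + d + 1) * ((r : ℝ) + d + 1 - (t + 1)) * i0 + ((r : ℝ) + d + 1) * (t + 1) * i1 + ((r:ℝ) + d + 1) * (r + d).factorial * key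

lemma desc_le (a b m : ℕ) (h : a ≤ b) :
    a.descFactorial m * b ^ m ≤ b.descFactorial m * a ^ m := by
  induction m with
  | zero => simp
  | succ m ih =>
    rw [Nat.descFactorial_succ, Nat.descFactorial_succ, pow_succ, pow_succ]
    have h1 : (a - m) * b ≤ (b - m) * a := by
      rw [Nat.sub_mul, Nat.sub_mul, mul_comm b a]
      exact Nat.sub_le_sub_left (Nat.mul_le_mul_left m h) _
    calc (a - m) * a.descFactorial m * (b ^ m * b)
        = ((a - m) * b) * (a.descFactorial m * b ^ m) := by ring
      _ ≤ ((b - m) * a) * (b.descFactorial m * a ^ m) := Nat.mul_le_mul h1 ih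
      _ = _ := by ring

lemma choose_ratio (a b m : ℕ) (h : a ≤ b) :
    (a.choose m : ℝ) * (b : ℝ) ^ m ≤ b.choose m * (a : ℝ) ^ m := by
  have := desc_le a b m h
  rw [Nat.descFactorial_eq_factorial_mul_choose, Nat.descFactorial_eq_factorial_mul_choose,
    mul_assoc, mul_assoc] at this
  have := Nat.le_of_mul_le_mul_left this (Nat.factorial_pos m)
  exact_mod_cast this

lemma tail_bound (k j n : ℕ) (hk : 2 ≤ k) (hj : j < k) (hn : k ≤ n + 1) (δ : ℝ) (h0 : 0 < δ)
    (h1 : δ < 1) :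
    ((Finset.univ.filter (fun ω : TreeSpace n => δ * (n + 1) ≤ cntV k (parN ω) j (n + 1))).card : ℝ)
      / n.factorial ≤ ((1 - δ) * ((n + 1) / n)) ^ (k - 1) := by
  obtain ⟨r, rfl⟩ : ∃ r, k = r + 1 := ⟨k - 1, by omega⟩
  obtain ⟨d, rfl⟩ : ∃ d, n = r + d := ⟨n - r, by omega⟩
  set n := r + d with hnd
  have hnpos : (0 : ℝ) < n := by exact_mod_cast (by omega : 0 < n)
  have hpos : 0 < δ * ((n : ℝ) + 1) := by positivity
  obtain ⟨s, hs⟩ : ∃ s, ⌈δ * ((n : ℝ) + 1)⌉₊ = s + 1 :=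
    ⟨⌈δ * ((n : ℝ) + 1)⌉₊ - 1, by have := Nat.ceil_pos.2 hpos; omega⟩
  have hsle : s + 1 ≤ n + 1 := by
    rw [← hs]; apply Nat.ceil_le.2; push_cast; nlinarith
  have hge : δ * ((n : ℝ) + 1) ≤ s + 1 := by
    have := Nat.le_ceil (δ * ((n : ℝ) + 1)); rw [hs] at this; exact_mod_cast this
  have hcard : (Finset.univ.filter (fun ω : TreeSpace n =>
      δ * (n + 1) ≤ cntV (r + 1) (parN ω) j (n + 1))).card = numA (r + 1) j n (s + 1) := by
    unfold numA
    rw [Finset.card_filter]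
    refine Finset.sum_congr rfl (fun ω _ => ?_)
    rw [← hs]
    simp only [Nat.ceil_le]
  rw [hcard]
  have hA := numA_eq r j (by omega) hj d s
  rw [← hnd] at hA
  have hch : (0 : ℝ) < n.choose r := by exact_mod_cast Nat.choose_pos (by omega)
  have hfac : (0 : ℝ) < n.factorial := by exact_mod_cast n.factorial_pos
  have hr := choose_ratio (n - s) n r (by omega)
  have e : (numA (r + 1) j n (s + 1) : ℝ) / n.factorial = (n - s).choose r / n.choose r := by
    rw [div_eq_div_iff hfac.ne' hch.ne', hA]; ring
  rw [e, Nat.add_sub_cancel]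
  have e2 : ((n - s).choose r : ℝ) / n.choose r ≤ (((n - s : ℕ) : ℝ) / n) ^ r := by
    rw [div_pow, div_le_div_iff₀ hch (by positivity)]
    linarith
  refine e2.trans (pow_le_pow_left₀ (by positivity) ?_ r)
  rw [Nat.cast_sub (by omega), mul_div_assoc']
  gcongr
  linarith

lemma treeMeasure_real (n : ℕ) (S : Set (TreeSpace n)) :
    (treeMeasure n S).toReal = ((Finset.univ.filter (fun ω => ω ∈ S)).card : ℝ) / n.factorial := by
  have hsing : ∀ ω : TreeSpace n, treeMeasure n {ω} = ENNReal.ofReal (1 / n.factorial) := by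
    intro ω
    unfold treeMeasure
    rw [Measure.pi_singleton]
    have : ∀ j : Fin n, (PMF.uniformOfFintype (Fin (j.1 + 1))).toMeasure {ω j}
        = ENNReal.ofReal (((j.1 + 1 : ℕ) : ℝ)⁻¹) := by
      intro j
      rw [PMF.toMeasure_apply_singleton _ _ (measurableSet_singleton _), PMF.uniformOfFintype_apply,
        Fintype.card_fin, ENNReal.ofReal_inv_of_pos (by positivity), ENNReal.ofReal_natCast]
    rw [Finset.prod_congr rfl (fun j _ => this j), ← ENNReal.ofReal_prod_of_nonneg (fun _ _ => by positivity)]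
    congr 1
    rw [Finset.prod_inv_distrib, one_div, ← Nat.cast_prod,
      Fin.prod_univ_eq_prod_range (fun i => i + 1) n, Finset.prod_range_add_one_eq_factorial]
  have hS : S = ((Finset.univ.filter (fun ω => ω ∈ S) : Finset (TreeSpace n)) : Set (TreeSpace n)) := by
    ext; simp
  conv_lhs => rw [hS]
  rw [← sum_measure_singleton, Finset.sum_congr rfl (fun ω _ => hsing ω), Finset.sum_const,
    nsmul_eq_mul, ENNReal.toReal_mul, ENNReal.toReal_natCast, ENNReal.toReal_ofReal (by positivity)]
  ring

lemma adj_parent {n : ℕ} (ω : TreeSpace n) (v : Fin (n + 1)) (hv : v.1 ≠ 0) :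
    (attachGraph ω).Adj v (parentVx ω v) := by
  unfold attachGraph
  rw [SimpleGraph.fromRel_adj]
  refine ⟨fun h => ?_, Or.inr rfl⟩
  have := parN_lt ω v.1 (by omega)
  rw [← parentVx_val, ← h] at this
  omega

lemma psi_root {n : ℕ} (ω : TreeSpace n) :
    ∃ j < 2, psiVal ω 0 ≤ cntV 2 (parN ω) j (n + 1) := by
  have hmain : ∀ c : ((attachGraph ω).induce ({0}ᶜ : Set (Fin (n + 1)))).ConnectedComponent,
      ∃ j < 2, c.supp.ncard ≤ cntV 2 (parN ω) j (n + 1) := by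
    intro c
    induction c using SimpleGraph.ConnectedComponent.ind with
    | _ v =>
    refine ⟨ancV 2 (parN ω) v.1.1, ancV_mem 2 (by norm_num) _ n _ (by omega)
      (fun u hu _ => parN_lt ω u hu), ?_⟩
    have hpar : ∀ a b : Fin (n + 1), a ≠ 0 → b ≠ 0 → parentVx ω b = a →
        ancV 2 (parN ω) a.1 = ancV 2 (parN ω) b.1 := by
      intro a b ha hb hab
      have hb' : b.1 ≠ 0 := fun h => hb (Fin.ext h)
      have ha' : a.1 ≠ 0 := fun h => ha (Fin.ext h)
      have hv := parentVx_val ω b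
      rw [hab] at hv
      have hl := parN_lt ω b.1 (by omega)
      rw [ancV_ge 2 _ b.1 (by omega) hl, hv]
    have hreach : ∀ u w : ({0}ᶜ : Set (Fin (n + 1))),
        ((attachGraph ω).induce ({0}ᶜ : Set (Fin (n + 1)))).Reachable u w →
        ancV 2 (parN ω) u.1.1 = ancV 2 (parN ω) w.1.1 := by
      intro u w ⟨p⟩
      induction p with
      | nil => rfl
      | @cons a b c hab _ ih =>
        rw [← ih]
        rw [SimpleGraph.induce_adj] at hab
        unfold attachGraph at hab
        rw [SimpleGraph.fromRel_adj] at hab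
        rcases hab.2 with h | h
        · exact hpar _ _ a.2 b.2 h
        · exact (hpar _ _ b.2 a.2 h).symm
    rw [← card_fin_anc, ← Set.ncard_coe_finset]
    refine Set.ncard_le_ncard_of_injOn (fun x => x.1) ?_ (Subtype.val_injective.injOn) (Set.toFinite _)
    intro x hx
    rw [SimpleGraph.ConnectedComponent.mem_supp_iff, SimpleGraph.ConnectedComponent.eq] at hx
    simpa using hreach _ _ hx
  have hpsi : psiVal ω 0 ≤ max (cntV 2 (parN ω) 0 (n + 1)) (cntV 2 (parN ω) 1 (n + 1)) := by
    apply ciSup_le'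
    intro c
    obtain ⟨j, hj, h⟩ := hmain c
    interval_cases j
    · exact h.trans (le_max_left _ _)
    · exact h.trans (le_max_right _ _)
  rcases le_max_iff.1 hpsi with h | h
  · exact ⟨0, by norm_num, h⟩
  · exact ⟨1, by norm_num, h⟩

lemma psi_late {n : ℕ} (ω : TreeSpace n) (k : ℕ) (hk : 0 < k) (i : Fin (n + 1)) (hi : k ≤ i.1) :
    n + 1 ≤ psiVal ω i + cntV k (parN ω) (ancV k (parN ω) i.1) (n + 1) := by
  set G := (attachGraph ω).induce ({i}ᶜ : Set (Fin (n + 1))) with hG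
  have hnot : ∀ v : Fin (n + 1), (v.1 < k ∨ ancV k (parN ω) v.1 ≠ ancV k (parN ω) i.1) → v ≠ i := by
    rintro v h rfl
    rcases h with h | h
    · omega
    · exact h rfl
  have h0 : (0 : Fin (n + 1)) ≠ i := hnot 0 (Or.inl (by simpa using hk))
  have hreach : ∀ m : ℕ, ∀ v : Fin (n + 1), v.1 = m →
      ∀ h : (v.1 < k ∨ ancV k (parN ω) v.1 ≠ ancV k (parN ω) i.1),
      G.Reachable ⟨v, hnot v h⟩ ⟨0, h0⟩ := by
    intro m
    induction m using Nat.strong_induction_on with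
    | _ m ih =>
      intro v hv h
      by_cases hz : v.1 = 0
      · have : v = 0 := Fin.ext hz
        subst this
        exact SimpleGraph.Reachable.refl _
      · have hl := parN_lt ω v.1 (by omega)
        have hp := parentVx_val ω v
        have h' : ((parentVx ω v).1 < k ∨
            ancV k (parN ω) (parentVx ω v).1 ≠ ancV k (parN ω) i.1) := by
          by_cases hvk : v.1 < k
          · left; omega
          · right
            rw [hp, ← ancV_ge k _ v.1 (by omega) hl]
            exact h.resolve_left hvk
        refine SimpleGraph.Reachable.trans (SimpleGraph.Adj.reachable ?_) (ih _ (by omega) (parentVx ω v) rfl h')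
        rw [hG, SimpleGraph.induce_adj]
        exact adj_parent ω v hz
  let c := G.connectedComponentMk ⟨0, h0⟩
  have hle : c.supp.ncard ≤ psiVal ω i := by
    unfold psiVal
    exact le_ciSup (f := fun c : G.ConnectedComponent => c.supp.ncard) (Set.toFinite _).bddAbove c
  have hfil := Finset.card_filter_add_card_filter_not (s := (Finset.univ : Finset (Fin (n + 1))))
    (fun x : Fin (n + 1) => ancV k (parN ω) x.1 = ancV k (parN ω) i.1)
  rw [Finset.card_univ, Fintype.card_fin, card_fin_anc] at hfil
  have hsub : (Finset.univ.filter (fun x : Fin (n + 1) =>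
      ¬ ancV k (parN ω) x.1 = ancV k (parN ω) i.1)).card ≤ c.supp.ncard := by
    rw [← Set.ncard_image_of_injective c.supp Subtype.val_injective, ← Set.ncard_coe_finset]
    refine Set.ncard_le_ncard ?_ (Set.toFinite _)
    intro v hv
    have hv' : ancV k (parN ω) v.1 ≠ ancV k (parN ω) i.1 := by simpa using hv
    refine ⟨⟨v, hnot v (Or.inr hv')⟩, ?_, rfl⟩
    rw [SimpleGraph.ConnectedComponent.mem_supp_iff, SimpleGraph.ConnectedComponent.eq]
    exact hreach _ v rfl (Or.inr hv')
  omega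

lemma event_incl (ε : ℝ) (K : ℕ) (hK0 : 0 < K) (n : ℕ) (ω : TreeSpace n) (S : Finset (Fin (n + 1)))
    (hS : S.card = K) (hmin : ∀ u ∈ S, ∀ w, w ∉ S → psiVal ω u ≤ psiVal ω w) (h0 : 0 ∉ S) :
    (∃ j ∈ Finset.range K, ε * (n + 1) ≤ cntV K (parN ω) j (n + 1)) ∨
    (∃ j ∈ Finset.range 2, (1 - ε) * (n + 1) ≤ cntV 2 (parN ω) j (n + 1)) := by
  obtain ⟨i, hiS, hi⟩ : ∃ i ∈ S, K ≤ i.1 := by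
    by_contra! hcon
    have : (S.image Fin.val) ⊆ Finset.Ico 1 K := by
      intro x hx
      obtain ⟨y, hy, rfl⟩ := Finset.mem_image.1 hx
      rw [Finset.mem_Ico]
      refine ⟨?_, hcon y hy⟩
      by_contra hy0
      exact h0 (by rwa [show (0 : Fin (n + 1)) = y from Fin.ext (by simp; omega)])
    have h2 := Finset.card_le_card this
    rw [Finset.card_image_of_injective _ Fin.val_injective, hS, Nat.card_Ico] at h2
    omega
  have hpsi := hmin i hiS 0 h0
  have hl := psi_late ω K hK0 i hi
  obtain ⟨j, hj, hr⟩ := psi_root ω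
  by_cases hc : ε * (n + 1) ≤ cntV K (parN ω) (ancV K (parN ω) i.1) (n + 1)
  · exact Or.inl ⟨_, Finset.mem_range.2 (ancV_mem K hK0 _ n _ (by omega)
      (fun u hu _ => parN_lt ω u hu)), hc⟩
  · right
    refine ⟨j, Finset.mem_range.2 hj, ?_⟩
    push Not at hc
    have h1 : ((n : ℝ) + 1) ≤ psiVal ω i + cntV K (parN ω) (ancV K (parN ω) i.1) (n + 1) := by
      exact_mod_cast hl
    have h2 : (psiVal ω i : ℝ) ≤ cntV 2 (parN ω) j (n + 1) := by exact_mod_cast hpsi.trans hr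
    linarith

lemma prob_bound (ε : ℝ) (hε : ε ∈ Set.Ioo (0 : ℝ) 1) (K : ℕ) (hK : 2 ≤ K) (n : ℕ) (hn : K ≤ n + 1)
    (H : TreeSpace n → Finset (Fin (n + 1))) (hcard : ∀ ω, (H ω).card = K)
    (hmin : ∀ ω : TreeSpace n, ∀ u ∈ H ω, ∀ w, w ∉ H ω → psiVal ω u ≤ psiVal ω w) :
    1 - (K * ((1 - ε) * ((n + 1) / n)) ^ (K - 1) + 2 * (ε * ((n + 1) / n))) ≤
      (treeMeasure n {ω | 0 ∈ H ω}).toReal := by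
  obtain ⟨he0, he1⟩ := hε
  rw [treeMeasure_real]
  simp only [Set.mem_ofPred_eq]
  have hfac : (0 : ℝ) < n.factorial := by exact_mod_cast n.factorial_pos
  have hfil := Finset.card_filter_add_card_filter_not (s := (Finset.univ : Finset (TreeSpace n)))
    (fun ω => 0 ∈ H ω)
  rw [Finset.card_univ, card_TS] at hfil
  set A : ℕ → Finset (TreeSpace n) := fun j =>
    Finset.univ.filter (fun ω : TreeSpace n => ε * (n + 1) ≤ cntV K (parN ω) j (n + 1)) with hA
  set B : ℕ → Finset (TreeSpace n) := fun j =>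
    Finset.univ.filter (fun ω : TreeSpace n => (1 - ε) * (n + 1) ≤ cntV 2 (parN ω) j (n + 1)) with hB
  have hsub : Finset.univ.filter (fun ω => ¬ 0 ∈ H ω) ⊆
      (Finset.range K).biUnion A ∪ (Finset.range 2).biUnion B := by
    intro ω hω
    have hω' : 0 ∉ H ω := by simpa using hω
    rw [Finset.mem_union, Finset.mem_biUnion, Finset.mem_biUnion]
    simpa [hA, hB] using event_incl ε K (by omega) n ω (H ω) (hcard ω) (hmin ω) hω'
  have hc1 : ((Finset.univ.filter (fun ω => ¬ 0 ∈ H ω)).card : ℝ) ≤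
      ∑ j ∈ Finset.range K, ((A j).card : ℝ) + ∑ j ∈ Finset.range 2, ((B j).card : ℝ) := by
    have := (Finset.card_le_card hsub).trans ((Finset.card_union_le _ _).trans
      (Nat.add_le_add Finset.card_biUnion_le Finset.card_biUnion_le))
    exact_mod_cast this
  have hAb : ∀ j ∈ Finset.range K, ((A j).card : ℝ) ≤ ((1 - ε) * ((n + 1) / n)) ^ (K - 1) * n.factorial := by
    intro j hj
    have := tail_bound K j n hK (Finset.mem_range.1 hj) hn ε he0 he1
    rwa [div_le_iff₀ hfac] at this
  have hBb : ∀ j ∈ Finset.range 2, ((B j).card : ℝ) ≤ (ε * ((n + 1) / n)) * n.factorial := by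
    intro j hj
    have := tail_bound 2 j n le_rfl (Finset.mem_range.1 hj) (by omega) (1 - ε) (by linarith) (by linarith)
    rw [div_le_iff₀ hfac] at this
    simpa using this
  have h1 := Finset.sum_le_sum hAb
  have h2 := Finset.sum_le_sum hBb
  rw [Finset.sum_const, Finset.card_range, nsmul_eq_mul] at h1 h2
  have hfil' : ((Finset.univ.filter (fun ω => 0 ∈ H ω)).card : ℝ) +
      (Finset.univ.filter (fun ω => ¬ 0 ∈ H ω)).card = n.factorial := by exact_mod_cast hfil
  rw [le_div_iff₀ hfac]
  push_cast at h2
  linarith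

lemma analytic (ε : ℝ) (he0 : 0 < ε) (he1 : ε < 1 / 5) (K : ℕ)
    (hK : (5 / 2) * Real.log (1 / ε) / ε ≤ K) :
    2 ≤ K ∧ (K : ℝ) * (1 - ε) ^ (K - 1) + 2 * ε ≤ 4 * ε / (1 - ε) := by
  have hL : 1 - ε ≤ Real.log (1 / ε) := by
    have := Real.one_sub_inv_le_log_of_pos (x := 1 / ε) (by positivity)
    simpa using this
  set L := Real.log (1 / ε) with hLdef
  rw [div_le_iff₀ he0] at hK
  set x := (K : ℝ) * ε with hx
  have hK2 : 2 ≤ K := by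
    have : (2 : ℝ) ≤ K := by
      by_contra hcon
      push Not at hcon
      nlinarith
    exact_mod_cast this
  refine ⟨hK2, ?_⟩
  have hexpL : Real.exp (-L) = ε := by
    rw [hLdef, one_div, Real.log_inv, neg_neg, Real.exp_log he0]
  have hp : (1 - ε) ^ K ≤ Real.exp (-x) := by
    calc (1 - ε) ^ K ≤ (Real.exp (-ε)) ^ K :=
          pow_le_pow_left₀ (by linarith) (by have := Real.add_one_le_exp (-ε); linarith) K
      _ = Real.exp (-x) := by rw [← Real.exp_nat_mul]; congr 1; rw [hx]; ring
  set x0 := 5 / 2 * L with hx0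
  have hx01 : 1 ≤ x0 := by rw [hx0]; linarith
  have h1 : x * Real.exp (-x) ≤ x0 * Real.exp (-x0) := by
    have e1 : Real.exp (-x0) = Real.exp (-x) * Real.exp (x - x0) := by
      rw [← Real.exp_add]; congr 1; ring
    have e2 := Real.add_one_le_exp (x - x0)
    have e3 : x ≤ x0 * Real.exp (x - x0) := by nlinarith
    rw [e1]
    have := mul_le_mul_of_nonneg_right e3 (Real.exp_pos (-x)).le
    linarith
  have h2 : x0 * Real.exp (-x0) ≤ 2 * ε ^ 2 := by
    have e1 : Real.exp (-x0) = ε ^ 2 * Real.exp (-(L / 2)) := by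
      rw [← hexpL, ← Real.exp_nat_mul, ← Real.exp_add]; congr 1; rw [hx0]; push_cast; ring
    have e2 : L / 2 ≤ Real.exp (L / 2 - 1) := by have := Real.add_one_le_exp (L / 2 - 1); linarith
    have e3 : Real.exp (L / 2) = Real.exp (L / 2 - 1) * Real.exp 1 := by
      rw [← Real.exp_add]; congr 1; ring
    have e4 := Real.exp_one_gt_d9
    have e5 : 5 / 2 * L ≤ 2 * Real.exp (L / 2) := by
      rw [e3]; nlinarith [Real.exp_pos (L / 2 - 1)]
    have e6 : 5 / 2 * L * Real.exp (-(L / 2)) ≤ 2 := by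
      have := mul_le_mul_of_nonneg_right e5 (Real.exp_pos (-(L / 2))).le
      rw [mul_assoc 2, ← Real.exp_add, add_neg_cancel, Real.exp_zero, mul_one] at this
      exact this
    rw [e1, hx0]
    have := mul_le_mul_of_nonneg_left e6 (sq_nonneg ε)
    linarith
  have h3 : (K : ℝ) * (1 - ε) ^ K ≤ 2 * ε := by
    have : ((K : ℝ) * (1 - ε) ^ K) * ε ≤ (2 * ε) * ε := by
      calc ((K : ℝ) * (1 - ε) ^ K) * ε = x * (1 - ε) ^ K := by rw [hx]; ring
        _ ≤ x * Real.exp (-x) := mul_le_mul_of_nonneg_left hp (by positivity)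
        _ ≤ 2 * ε ^ 2 := h1.trans h2
        _ = _ := by ring
    exact le_of_mul_le_mul_right this he0
  have hpos : 0 < 1 - ε := by linarith
  rw [le_div_iff₀ hpos, add_mul, mul_assoc, ← pow_succ, Nat.sub_add_cancel (by omega)]
  nlinarith

/-- Centroid-based root finding in uniform attachment trees: if `ε ∈ (0,1)`,
`K ≥ (5/2)·ln(1/ε)/ε`, and `H` selects, for every realization of the uniform attachment
tree, a set of `K` vertices with the `K` smallest values of `ψ`, then
`liminf_n P(root ∈ H) ≥ 1 - 4ε/(1-ε)`. -/
theorem uniform_attachment_centroid_root_finding (ε : ℝ) (hε : ε ∈ Set.Ioo (0 : ℝ) 1)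
    (K : ℕ) (hK : (5 / 2) * Real.log (1 / ε) / ε ≤ K)
    (H : (n : ℕ) → TreeSpace n → Finset (Fin (n + 1)))
    (hcard : ∀ n, K ≤ n + 1 → ∀ ω : TreeSpace n, (H n ω).card = K)
    (hmin : ∀ n, ∀ ω : TreeSpace n, ∀ u ∈ H n ω, ∀ w, w ∉ H n ω →
      psiVal ω u ≤ psiVal ω w) :
    1 - 4 * ε / (1 - ε) ≤
      atTop.liminf fun n => (treeMeasure n {ω | 0 ∈ H n ω}).toReal := by
  obtain ⟨he0, he1⟩ := hε
  have hbd : ∀ n, (treeMeasure n {ω | 0 ∈ H n ω}).toReal ≤ 1 := by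
    intro n
    rw [treeMeasure_real, div_le_one (by exact_mod_cast n.factorial_pos), ← card_TS]
    exact_mod_cast Finset.card_le_univ _
  have hcob : IsCoboundedUnder (· ≥ ·) atTop
      (fun n => (treeMeasure n {ω | 0 ∈ H n ω}).toReal) :=
    (isBoundedUnder_of ⟨1, hbd⟩ : IsBoundedUnder (· ≤ ·) atTop _).isCoboundedUnder_ge
  rcases lt_or_ge ε (1 / 5) with h5 | h5
  · obtain ⟨hK2, hfin⟩ := analytic ε he0 h5 K hK
    have hlim1 : Tendsto (fun n : ℕ => ((n : ℝ) + 1) / n) atTop (𝓝 1) := by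
      have h := (tendsto_const_nhds (x := (1 : ℝ))).add tendsto_one_div_atTop_nhds_zero_nat
      rw [add_zero] at h
      refine h.congr' ?_
      filter_upwards [eventually_gt_atTop 0] with n hn
      have : (n : ℝ) ≠ 0 := by positivity
      field_simp
    have hlim : Tendsto (fun n : ℕ => 1 - (K * ((1 - ε) * (((n : ℝ) + 1) / n)) ^ (K - 1)
        + 2 * (ε * (((n : ℝ) + 1) / n)))) atTop
        (𝓝 (1 - (K * ((1 - ε) * 1) ^ (K - 1) + 2 * (ε * 1)))) :=
      tendsto_const_nhds.sub ((((hlim1.const_mul _).pow _).const_mul _).add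
        ((hlim1.const_mul _).const_mul _))
    rw [mul_one, mul_one] at hlim
    refine le_trans ?_ (le_trans hlim.liminf_eq.ge
      (liminf_le_liminf ?_ hlim.isBoundedUnder_ge hcob))
    · linarith
    · filter_upwards [eventually_ge_atTop K] with n hn
      exact prob_bound ε ⟨he0, he1⟩ K hK2 n (by omega) (H n) (hcard n (by omega)) (hmin n)
  · have hneg : 1 - 4 * ε / (1 - ε) ≤ 0 := by
      have : 1 ≤ 4 * ε / (1 - ε) := by
        rw [le_div_iff₀ (by linarith)]; linarith
      linarith
    refine hneg.trans (le_liminf_of_le hcob (Eventually.of_forall fun n => ENNReal.toReal_nonneg))
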